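/- Let k be a solid and incremental assignment. For every j ≥ 0, the Hilbert function of 𝒫_k satisfies h_k(j) = h_X(j) + Σ_I C(j − #X(I) + n − #I − 1, n − #I − 1), where h_k(j) := dim(𝒫_k ∩ Π_j^0), the sum runs over all I ∈ 𝕀(X)∖𝔹(X) with j − k(I) ≤ #X(I) ≤ j, and h_X(j) := #{B ∈ 𝔹(X) : #X(B) = j}. -/

import Mathlib

open MvPolynomial

noncomputable section

/-- The linear polynomial `p_x : t ↦ x ⬝ t`. -/
def pLin (n : ℕ) (x : Fin n → ℝ) : MvPolynomial (Fin n) ℝ :=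
  ∑ i, MvPolynomial.C (x i) * MvPolynomial.X i

/-- `p_Z = ∏_{x ∈ Z} p_x` for a sub-multiset `Z` of the multiset indexed by `ι`. -/
def pProd (n : ℕ) {ι : Type} (v : ι → Fin n → ℝ) (Z : Finset ι) : MvPolynomial (Fin n) ℝ :=
  ∏ a ∈ Z, pLin n (v a)

/-- `q_Z = ∏_{x ∈ Z} (p_x - λ_x)`. -/
def qProd (n : ℕ) {ι : Type} (v : ι → Fin n → ℝ) (lam : ι → ℝ) (Z : Finset ι) :
    MvPolynomial (Fin n) ℝ :=
  ∏ a ∈ Z, (pLin n (v a) - MvPolynomial.C (lam a))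

/-- The pairing `⟨p,q⟩ = (p(∂)q)(0) = ∑_α α! p_α q_α`. -/
def pairing (n : ℕ) (p q : MvPolynomial (Fin n) ℝ) : ℝ :=
  ∑ α ∈ p.support, p.coeff α * q.coeff α * (α.prod fun _ e => (Nat.factorial e : ℝ))

/-- `B` is a basis of the multiset: its vectors form a basis of `ℝ^n`. -/
def IsBasisSet (n : ℕ) {ι : Type} (v : ι → Fin n → ℝ) (B : Finset ι) : Prop :=
  LinearIndependent ℝ (fun b : B => v b) ∧ Submodule.span ℝ (v '' ↑B) = ⊤

/-- The ideal `𝒥_{𝔹'}` generated by the `p_Z` over all `Z` meeting every `B ∈ 𝔹'`. -/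
def Jideal (n : ℕ) {ι : Type} [DecidableEq ι] (v : ι → Fin n → ℝ) (𝔹' : Set (Finset ι)) :
    Ideal (MvPolynomial (Fin n) ℝ) :=
  Ideal.span {p | ∃ Z : Finset ι, (∀ B ∈ 𝔹', (Z ∩ B).Nonempty) ∧ p = pProd n v Z}

/-- The kernel space `𝒟_{𝔹'}`. -/
def Dspace (n : ℕ) {ι : Type} [DecidableEq ι] (v : ι → Fin n → ℝ) (𝔹' : Set (Finset ι)) :
    Submodule ℝ (MvPolynomial (Fin n) ℝ) where
  carrier := {f | ∀ g ∈ Jideal n v 𝔹', pairing n g f = 0}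
  zero_mem' := by intro g _; simp [pairing]
  add_mem' := by
    intro a b ha hb g hg
    have h : pairing n g (a + b) = pairing n g a + pairing n g b := by
      simp only [pairing, MvPolynomial.coeff_add]
      rw [← Finset.sum_add_distrib]
      exact Finset.sum_congr rfl fun α _ => by ring
    rw [h, ha g hg, hb g hg, add_zero]
  smul_mem' := by
    intro c f hf g hg
    have h : pairing n g (c • f) = c * pairing n g f := by
      simp only [pairing, MvPolynomial.coeff_smul, smul_eq_mul, Finset.mul_sum]
      exact Finset.sum_congr rfl fun α _ => by ring
    rw [h, hf g hg, mul_zero]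

/-- A solid assignment `k : 2^X → ℕ`. -/
def Solid (n : ℕ) {ι : Type} (v : ι → Fin n → ℝ) (k : Finset ι → ℕ) : Prop :=
  ∀ Z Z' : Finset ι,
    Submodule.span ℝ (v '' ↑Z) ≤ Submodule.span ℝ (v '' ↑Z') → k Z ≤ k Z'

/-- An incremental assignment. -/
def Incremental {ι : Type} [DecidableEq ι] (k : Finset ι → ℕ) : Prop :=
  ∀ (Z : Finset ι) (x : ι), k (insert x Z) ≤ k Z + 1

/-- `m(I) = k(I) + n - #I`. -/
def mVal (n : ℕ) {ι : Type} (k : Finset ι → ℕ) (I : Finset ι) : ℕ := k I + n - I.card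

/-- `B ∩ X` for `B ⊆ X ∪ Y`. -/
def leftPart {ι : Type} [Fintype ι] [DecidableEq ι] {M : ℕ} (B : Finset (ι ⊕ Fin M)) :
    Finset ι :=
  Finset.univ.filter fun i => Sum.inl i ∈ B

/-- `B ∩ Y` for `B ⊆ X ∪ Y`, as a set of indices in `Y`. -/
def rightPart {ι : Type} [Fintype ι] [DecidableEq ι] {M : ℕ} (B : Finset (ι ⊕ Fin M)) :
    Finset (Fin M) :=
  Finset.univ.filter fun j => Sum.inr j ∈ B

/-- `Y_i = {y_1, …, y_i}` as a set of indices. -/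
def YFin {M : ℕ} (i : ℕ) : Finset (Fin M) := Finset.univ.filter fun j => (j : ℕ) < i

/-- `X ∪ Y_i` as a subset of the index set of `X ∪ Y`. -/
def XYup (ι : Type) [Fintype ι] [DecidableEq ι] (M : ℕ) (i : ℕ) : Finset (ι ⊕ Fin M) :=
  Finset.univ.image Sum.inl ∪ (YFin (M := M) i).image Sum.inr

/-- `Y` is in general position in `X ∪ Y`: no `y ∈ Y` lies in the span of fewer than `n`
vectors of `(X ∪ Y) ∖ {y}`. -/
def GeneralPosition (n : ℕ) {ι : Type} [Fintype ι] [DecidableEq ι] {M : ℕ}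
    (v : ι → Fin n → ℝ) (y : Fin M → Fin n → ℝ) : Prop :=
  ∀ (j : Fin M) (S : Finset (ι ⊕ Fin M)), Sum.inr j ∉ S → S.card < n →
    y j ∉ Submodule.span ℝ (Sum.elim v y '' ↑S)

/-- `𝔹_k : the bases `B` of `X ∪ Y` with `B ∩ Y ⊆ Y_{m(B ∩ X)}`. -/
def Bk (n : ℕ) {ι : Type} [Fintype ι] [DecidableEq ι] (v : ι → Fin n → ℝ) {M : ℕ}
    (y : Fin M → Fin n → ℝ) (k : Finset ι → ℕ) : Set (Finset (ι ⊕ Fin M)) :=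
  {B | IsBasisSet n (Sum.elim v y) B ∧
    ∀ j : Fin M, Sum.inr j ∈ B → (j : ℕ) < mVal n k (leftPart B)}

/-- The space `𝒫_k = ∑_{Z ⊆ X} p_{X∖Z} Π_{k(Z)}`. -/
def Pspace (n : ℕ) {ι : Type} [Fintype ι] [DecidableEq ι] (v : ι → Fin n → ℝ)
    (k : Finset ι → ℕ) : Submodule ℝ (MvPolynomial (Fin n) ℝ) :=
  ⨆ Z : Finset ι,
    Submodule.map (LinearMap.mulLeft ℝ (pProd n v (Finset.univ \ Z)))
      (MvPolynomial.restrictTotalDegree (Fin n) ℝ (k Z))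

/-- The constants `λ` are generic: each basis `B` determines a point `bp B` at which
`q_z` vanishes exactly when `z ∈ B`. -/
def Generic (n : ℕ) {ι : Type} (v : ι → Fin n → ℝ) (lam : ι → ℝ)
    (bp : Finset ι → Fin n → ℝ) : Prop :=
  ∀ B : Finset ι, IsBasisSet n v B →
    ∀ z : ι, MvPolynomial.eval (bp B) (pLin n (v z) - MvPolynomial.C (lam z)) = 0 ↔ z ∈ B

/-- `x` is placable in `𝔹'`. -/
def Placable {ι : Type} [DecidableEq ι] (x : ι) (𝔹' : Set (Finset ι)) : Prop :=
  ∀ B ∈ 𝔹', ∃ a ∈ B, (insert x B).erase a ∈ 𝔹'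

/-- `𝔹'` is placible. -/
inductive Placible {ι : Type} [DecidableEq ι] : Set (Finset ι) → Prop
  | singleton (B : Finset ι) : Placible {B}
  | split (𝔹' : Set (Finset ι)) (x : ι) (hx : Placable x 𝔹')
      (hne1 : {B ∈ 𝔹' | x ∈ B}.Nonempty) (hne2 : {B ∈ 𝔹' | x ∉ B}.Nonempty)
      (hp1 : Placible {B ∈ 𝔹' | x ∈ B}) (hp2 : Placible {B ∈ 𝔹' | x ∉ B}) :
      Placible 𝔹'

/-- `X(I)` : the elements of `X ∖ I` not in the span of the earlier elements of `I`. -/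
def XsetI (n : ℕ) {ι : Type} [Fintype ι] [DecidableEq ι] [LinearOrder ι]
    (v : ι → Fin n → ℝ) (I : Finset ι) : Finset ι := by
  classical
  exact Finset.univ.filter fun x =>
    x ∉ I ∧ v x ∉ Submodule.span ℝ (v '' {b | b ∈ I ∧ b < x})

/-- `X'(B)` for `B ⊆ X ∪ Y`, with the order on `X ∪ Y` putting `X` (with its own order)
before `Y` (ordered as given). -/
def XprimeB (n : ℕ) {ι : Type} [Fintype ι] [DecidableEq ι] [LinearOrder ι] {M : ℕ}
    (v : ι → Fin n → ℝ) (y : Fin M → Fin n → ℝ) (B : Finset (ι ⊕ Fin M)) :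
    Finset (ι ⊕ Fin M) := by
  classical
  exact Finset.univ.filter fun z =>
    z ∉ B ∧ Sum.elim v y z ∉ Submodule.span ℝ
      (Sum.elim v y '' {b | b ∈ B ∧ Sum.Lex (· < ·) (· < ·) b z})

/-- The least space `Π(Θ)`. -/
def leastSpace (n : ℕ) (Θ : Finset (Fin n → ℝ)) : Submodule ℝ (MvPolynomial (Fin n) ℝ) :=
  Submodule.span ℝ
    {f | ∃ (c : (Fin n → ℝ) → ℝ) (J : ℕ),
      f = (Nat.factorial J : ℝ)⁻¹ • ∑ θ ∈ Θ, c θ • pLin n θ ^ J ∧ f ≠ 0 ∧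
      ∀ j < J, ∑ θ ∈ Θ, c θ • pLin n θ ^ j = 0}

/-- The central space `𝒫(X)`, spanned by the `p_Z` over short `Z`. -/
def centralP (n : ℕ) {ι : Type} [Fintype ι] [DecidableEq ι] (v : ι → Fin n → ℝ) :
    Submodule ℝ (MvPolynomial (Fin n) ℝ) :=
  Submodule.span ℝ
    {p | ∃ Z : Finset ι, Submodule.span ℝ (v '' ↑(Finset.univ \ Z)) = ⊤ ∧ p = pProd n v Z}

end

/-- The right-hand side of the Hilbert function formula:
`h_X(j) + ∑_I C(j − #X(I) + n − #I − 1, n − #I − 1)`, the sum over all independent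
non-basis `I ⊆ X` with `j − k(I) ≤ #X(I) ≤ j`. -/
noncomputable def hilbRHS (n : ℕ) (ι : Type) [Fintype ι] [DecidableEq ι] [LinearOrder ι]
    (v : ι → Fin n → ℝ) (k : Finset ι → ℕ) (j : ℕ) : ℕ := by
  classical
  exact Set.ncard {B : Finset ι | IsBasisSet n v B ∧ (XsetI n v B).card = j} +
    ∑ I ∈ Finset.univ.filter (fun I : Finset ι =>
        (LinearIndependent ℝ fun i : I => v i) ∧ ¬ IsBasisSet n v I ∧
        j - k I ≤ (XsetI n v I).card ∧ (XsetI n v I).card ≤ j),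
      Nat.choose (j - (XsetI n v I).card + n - I.card - 1) (n - I.card - 1)

set_option linter.unusedSectionVars false

noncomputable section

lemma pLin_add (n : ℕ) (x y : Fin n → ℝ) : pLin n (x + y) = pLin n x + pLin n y := by
  simp [pLin, add_mul, Finset.sum_add_distrib]

lemma pLin_smul (n : ℕ) (c : ℝ) (x : Fin n → ℝ) : pLin n (c • x) = c • pLin n x := by
  simp [pLin, Finset.smul_sum, MvPolynomial.smul_eq_C_mul, mul_assoc]

/-- `pLin` as a linear map. -/
def pLinL (n : ℕ) : (Fin n → ℝ) →ₗ[ℝ] MvPolynomial (Fin n) ℝ where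
  toFun := pLin n
  map_add' := pLin_add n
  map_smul' := pLin_smul n

lemma pLinL_apply (n : ℕ) (x : Fin n → ℝ) : pLinL n x = pLin n x := rfl

lemma pLin_single (n : ℕ) (i : Fin n) : pLin n (Pi.single i 1) = MvPolynomial.X i := by
  rw [pLin, Finset.sum_eq_single i]
  · simp
  · intro b _ hb
    simp [hb]
  · simp

lemma pLin_eq_zero {n : ℕ} {x : Fin n → ℝ} (h : pLin n x = 0) : x = 0 := by
  funext i
  have h2 : MvPolynomial.eval (Pi.single i 1) (pLin n x) = 0 := by rw [h]; simp
  simpa [pLin, Pi.single_apply] using h2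

lemma pLin_zero (n : ℕ) : pLin n 0 = 0 := by simp [pLin]

lemma pLin_hom (n : ℕ) (x : Fin n → ℝ) : (pLin n x).IsHomogeneous 1 := by
  apply MvPolynomial.IsHomogeneous.sum
  intro i _
  exact MvPolynomial.isHomogeneous_C_mul_X _ _

lemma pProd_hom (n : ℕ) {ι : Type} (v : ι → Fin n → ℝ) (Z : Finset ι) :
    (pProd n v Z).IsHomogeneous Z.card := by
  have := MvPolynomial.IsHomogeneous.prod Z (fun a => pLin n (v a)) (fun _ => 1)
    (fun a _ => pLin_hom n (v a))
  simpa [pProd] using this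

/-- substitution along a linear map. -/
def sub' {a b : ℕ} (L : (Fin a → ℝ) →ₗ[ℝ] (Fin b → ℝ)) :
    MvPolynomial (Fin a) ℝ →ₐ[ℝ] MvPolynomial (Fin b) ℝ :=
  MvPolynomial.aeval (fun i => pLin b (L (Pi.single i 1)))

lemma sub'_X {a b : ℕ} (L : (Fin a → ℝ) →ₗ[ℝ] (Fin b → ℝ)) (i : Fin a) :
    sub' L (MvPolynomial.X i) = pLin b (L (Pi.single i 1)) := by
  simp [sub']

lemma sub'_pLin {a b : ℕ} (L : (Fin a → ℝ) →ₗ[ℝ] (Fin b → ℝ)) (x : Fin a → ℝ) :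
    sub' L (pLin a x) = pLin b (L x) := by
  have : (sub' L).toLinearMap ∘ₗ pLinL a = pLinL b ∘ₗ L := by
    apply LinearMap.pi_ext'
    intro i
    ext1
    simp [pLinL_apply, pLin_single, sub'_X]
  exact LinearMap.congr_fun this x

lemma sub'_comp {a b c : ℕ} (L : (Fin a → ℝ) →ₗ[ℝ] (Fin b → ℝ))
    (K : (Fin b → ℝ) →ₗ[ℝ] (Fin c → ℝ)) (f : MvPolynomial (Fin a) ℝ) :
    sub' K (sub' L f) = sub' (K ∘ₗ L) f := by
  have : (sub' K).comp (sub' L) = sub' (K ∘ₗ L) := by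
    apply MvPolynomial.algHom_ext
    intro i
    simp [sub'_X, sub'_pLin]
  exact DFunLike.congr_fun this f

lemma sub'_id {a : ℕ} (f : MvPolynomial (Fin a) ℝ) :
    sub' (LinearMap.id) f = f := by
  have : sub' (LinearMap.id : (Fin a → ℝ) →ₗ[ℝ] (Fin a → ℝ)) = AlgHom.id ℝ _ := by
    apply MvPolynomial.algHom_ext
    intro i
    simp [sub'_X, pLin_single]
  exact DFunLike.congr_fun this f

lemma sub'_hom {a b : ℕ} (L : (Fin a → ℝ) →ₗ[ℝ] (Fin b → ℝ)) {f : MvPolynomial (Fin a) ℝ}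
    {d : ℕ} (hf : f.IsHomogeneous d) : (sub' L f).IsHomogeneous d := by
  have := hf.aeval (fun i => pLin b (L (Pi.single i 1))) (n := 1) (fun i => pLin_hom _ _)
  simpa [sub'] using this

/-- codimension -/
abbrev cod {n : ℕ} (W : Submodule ℝ (Fin n → ℝ)) : ℕ := Module.finrank ℝ ((Fin n → ℝ) ⧸ W)

/-- projection with kernel `W` -/
def prj {n : ℕ} (W : Submodule ℝ (Fin n → ℝ)) : (Fin n → ℝ) →ₗ[ℝ] (Fin (cod W) → ℝ) :=
  (Module.finBasis ℝ ((Fin n → ℝ) ⧸ W)).equivFun.toLinearMap ∘ₗ W.mkQ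

lemma prj_eq_zero {n : ℕ} (W : Submodule ℝ (Fin n → ℝ)) (x : Fin n → ℝ) :
    prj W x = 0 ↔ x ∈ W := by
  simp only [prj, LinearMap.comp_apply, LinearEquiv.coe_coe]
  rw [LinearEquiv.map_eq_zero_iff]
  simp

lemma exists_sec {n : ℕ} (W : Submodule ℝ (Fin n → ℝ)) :
    ∃ s : (Fin (cod W) → ℝ) →ₗ[ℝ] (Fin n → ℝ), prj W ∘ₗ s = LinearMap.id := by
  apply LinearMap.exists_rightInverse_of_surjective
  rw [LinearMap.range_eq_top]
  intro z
  obtain ⟨w, hw⟩ := W.mkQ_surjective ((Module.finBasis ℝ ((Fin n → ℝ) ⧸ W)).equivFun.symm z)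
  exact ⟨w, by
    simp only [prj, LinearMap.comp_apply, hw]
    exact LinearEquiv.apply_symm_apply _ _⟩

/-- section -/
def sec {n : ℕ} (W : Submodule ℝ (Fin n → ℝ)) : (Fin (cod W) → ℝ) →ₗ[ℝ] (Fin n → ℝ) :=
  (exists_sec W).choose

lemma prj_sec {n : ℕ} (W : Submodule ℝ (Fin n → ℝ)) : prj W ∘ₗ sec W = LinearMap.id :=
  (exists_sec W).choose_spec

lemma sub_sec_prj_mem {n : ℕ} (W : Submodule ℝ (Fin n → ℝ)) (x : Fin n → ℝ) :
    x - sec W (prj W x) ∈ W := by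
  rw [← prj_eq_zero, map_sub, sub_eq_zero]
  exact (LinearMap.congr_fun (prj_sec W) (prj W x)).symm

lemma prj_factor {n : ℕ} {W W' : Submodule ℝ (Fin n → ℝ)} (h : W ≤ W') :
    (prj W' ∘ₗ sec W) ∘ₗ prj W = prj W' := by
  apply LinearMap.ext
  intro x
  have := h (sub_sec_prj_mem W x)
  rw [← prj_eq_zero, map_sub, sub_eq_zero] at this
  exact this.symm

lemma sub_prj_of_le {n : ℕ} {W W' : Submodule ℝ (Fin n → ℝ)} (h : W ≤ W')
    {f : MvPolynomial (Fin n) ℝ} (hf : sub' (prj W) f = 0) : sub' (prj W') f = 0 := by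
  rw [← prj_factor h, ← sub'_comp, hf, map_zero]

lemma sub_prj_sec {n : ℕ} (W : Submodule ℝ (Fin n → ℝ)) (f : MvPolynomial (Fin (cod W)) ℝ) :
    sub' (prj W) (sub' (sec W) f) = f := by
  rw [sub'_comp, prj_sec, sub'_id]

/-- span of the vectors indexed by `I` -/
def spn {n : ℕ} {ι : Type} (v : ι → Fin n → ℝ) (I : Finset ι) : Submodule ℝ (Fin n → ℝ) :=
  Submodule.span ℝ (v '' ↑I)

lemma spn_mono {n : ℕ} {ι : Type} (v : ι → Fin n → ℝ) {I J : Finset ι} (h : I ⊆ J) :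
    spn v I ≤ spn v J := Submodule.span_mono (Set.image_mono (by exact_mod_cast h))

lemma finrank_hom (m d : ℕ) :
    Module.finrank ℝ (MvPolynomial.homogeneousSubmodule (Fin m) ℝ d) = Nat.multichoose m d := by
  rw [MvPolynomial.homogeneousSubmodule_eq_finsupp_supported]
  rw [LinearEquiv.finrank_eq (AddMonoidAlgebra.supportedEquivFinsupp _)]
  have e : {x : Fin m →₀ ℕ | x.degree = d} =
      ((Finset.univ : Finset (Fin m)).finsuppAntidiag d : Set (Fin m →₀ ℕ)) := by
    ext x
    simp [Finset.mem_finsuppAntidiag, Finsupp.degree_eq_sum]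
  rw [e]
  have := Finset.card_finsuppAntidiag_nat_eq_multichoose (s := (Finset.univ : Finset (Fin m))) d
  simp only [Finset.card_univ, Fintype.card_fin] at this
  rw [← this]
  rw [Module.finrank_finsupp_self]
  simp


section comb
variable {n : ℕ} {ι : Type} [Fintype ι] [LinearOrder ι] (v : ι → Fin n → ℝ)

lemma mem_XsetI (I : Finset ι) (x : ι) : x ∈ XsetI n v I ↔
    x ∉ I ∧ v x ∉ Submodule.span ℝ (v '' {b | b ∈ I ∧ b < x}) := by
  simp [XsetI]

lemma LI_notMem {I A : Finset ι} (hI : LinearIndependent ℝ (fun i : I => v i)) (hA : A ⊆ I)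
    {x : ι} (hx : x ∈ I) (hxA : x ∉ A) : v x ∉ spn v A := by
  have := hI.notMem_span_image (s := {a : I | a.1 ∈ A}) (x := ⟨x, hx⟩) hxA
  have e : (fun i : I => v i) '' {a : I | a.1 ∈ A} = v '' (A : Set ι) := by
    ext w
    constructor
    · rintro ⟨a, ha, rfl⟩
      exact ⟨a.1, ha, rfl⟩
    · rintro ⟨a, ha, rfl⟩
      exact ⟨⟨a, hA ha⟩, ha, rfl⟩
  rw [e] at this
  exact this

lemma indep_aux (h : ∀ I : Finset ι, MvPolynomial (Fin (cod (spn v I))) ℝ) (R : Finset ι) :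
    ∀ A : Finset ι, (∀ a ∈ A, ∀ r ∈ R, a < r) → ∀ S : Finset (Finset ι),
      (∀ I, I ∈ S ↔ (LinearIndependent ℝ (fun i : I => v i)) ∧ A ⊆ I ∧ I ⊆ A ∪ R) →
      sub' (prj (spn v A)) (∑ I ∈ S, pProd n v (XsetI n v I ∩ R) * sub' (sec (spn v I)) (h I)) = 0 →
      ∀ I ∈ S, h I = 0 := by
  induction R using Finset.induction_on_min with
  | empty =>
    intro A _ S hS hsum I hI
    have hIA : ∀ I ∈ S, I = A := by
      intro I hI
      obtain ⟨_, h1, h2⟩ := (hS I).1 hI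
      exact Finset.Subset.antisymm (by simpa using h2) h1
    have hSA : S = {A} := by
      apply Finset.eq_singleton_iff_unique_mem.2
      exact ⟨hIA I hI ▸ hI, hIA⟩
    obtain rfl := hIA I hI
    rw [hSA] at hsum
    simpa [pProd, sub_prj_sec] using hsum
  | insert x R hx ih =>
    intro A hA S hS hsum
    have hxA : x ∉ A := fun hc => lt_irrefl x (hA x hc x (by simp))
    have hxR : x ∉ R := fun hc => lt_irrefl x (hx x hc)
    have hAR : ∀ a ∈ A, ∀ r ∈ R, a < r := fun a ha r hr => hA a ha r (by simp [hr])
    have hlow : ∀ I ∈ S, x ∉ I → v '' {b | b ∈ I ∧ b < x} = v '' (A : Set ι) := by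
      intro I hI hxI
      obtain ⟨_, h1, h2⟩ := (hS I).1 hI
      congr 1
      ext b
      constructor
      · rintro ⟨hb, hbx⟩
        have := h2 hb
        simp only [Finset.mem_union, Finset.mem_insert] at this
        rcases this with h | h | h
        · exact h
        · exact absurd hb (h ▸ hxI)
        · exact absurd (hx b h) (not_lt.2 hbx.le)
      · intro hb
        exact ⟨h1 hb, hA b hb x (by simp)⟩
    have hS2 : ∀ I, I ∈ S.filter (fun I => x ∉ I) ↔
        (LinearIndependent ℝ (fun i : I => v i)) ∧ A ⊆ I ∧ I ⊆ A ∪ R := by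
      intro I
      rw [Finset.mem_filter, hS]
      constructor
      · rintro ⟨⟨h1, h2, h3⟩, h4⟩
        refine ⟨h1, h2, fun b hb => ?_⟩
        have := h3 hb
        simp only [Finset.mem_union, Finset.mem_insert] at this ⊢
        rcases this with h | h | h
        · exact Or.inl h
        · exact absurd hb (h ▸ h4)
        · exact Or.inr h
      · rintro ⟨h1, h2, h3⟩
        refine ⟨⟨h1, h2, h3.trans ?_⟩, fun hc => ?_⟩
        · exact Finset.union_subset_union_right (Finset.subset_insert _ _)
        · rcases Finset.mem_union.1 (h3 hc) with h | h
          · exact hxA h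
          · exact hxR h
    by_cases hxs : v x ∈ spn v A
    · have hxI : ∀ I ∈ S, x ∉ I := by
        intro I hI hc
        obtain ⟨h0, h1, h2⟩ := (hS I).1 hI
        exact LI_notMem v h0 h1 hc hxA hxs
      have hSf : S.filter (fun I => x ∉ I) = S := Finset.filter_true_of_mem hxI
      rw [hSf] at hS2
      apply ih A hAR S hS2
      rw [← hsum]
      congr 1
      apply Finset.sum_congr rfl
      intro I hI
      rw [Finset.inter_insert_of_notMem]
      rw [mem_XsetI, hlow I hI (hxI I hI)]
      exact fun hc => hc.2 hxs
    · rw [← Finset.sum_filter_add_sum_filter_not S (fun I => x ∈ I)] at hsum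
      have hS1 : ∀ I, I ∈ S.filter (fun I => x ∈ I) ↔
        (LinearIndependent ℝ (fun i : I => v i)) ∧ insert x A ⊆ I ∧ I ⊆ insert x A ∪ R := by
        intro I
        rw [Finset.mem_filter, hS, Finset.insert_subset_iff, Finset.insert_union,
          Finset.union_insert]
        tauto
      have e1 : ∑ I ∈ S.filter (fun I => x ∈ I),
          pProd n v (XsetI n v I ∩ insert x R) * sub' (sec (spn v I)) (h I) =
          ∑ I ∈ S.filter (fun I => x ∈ I),
          pProd n v (XsetI n v I ∩ R) * sub' (sec (spn v I)) (h I) := by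
        apply Finset.sum_congr rfl
        intro I hI
        rw [Finset.inter_insert_of_notMem]
        rw [mem_XsetI]
        exact fun hc => hc.1 (Finset.mem_filter.1 hI).2
      have e2 : ∑ I ∈ S.filter (fun I => x ∉ I),
          pProd n v (XsetI n v I ∩ insert x R) * sub' (sec (spn v I)) (h I) =
          pLin n (v x) * ∑ I ∈ S.filter (fun I => x ∉ I),
          pProd n v (XsetI n v I ∩ R) * sub' (sec (spn v I)) (h I) := by
        rw [Finset.mul_sum]
        apply Finset.sum_congr rfl
        intro I hI
        obtain ⟨hI1, hI2⟩ := Finset.mem_filter.1 hI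
        rw [Finset.inter_insert_of_mem]
        · rw [pProd, Finset.prod_insert (by simp [hxR]), mul_assoc]
          rfl
        · rw [mem_XsetI, hlow I hI1 hI2]
          exact ⟨hI2, hxs⟩
      rw [e1, e2] at hsum
      have hle : spn v A ≤ spn v (insert x A) := spn_mono v (Finset.subset_insert _ _)
      have hsum1 := sub_prj_of_le hle hsum
      have hx0 : prj (spn v (insert x A)) (v x) = 0 := by
        rw [prj_eq_zero]
        exact Submodule.subset_span ⟨x, by simp, rfl⟩
      rw [map_add, map_mul, sub'_pLin, hx0, pLin_zero, zero_mul, add_zero] at hsum1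
      have r1 := ih (insert x A) (by
        intro a ha r hr
        rcases Finset.mem_insert.1 ha with h | h
        · exact h ▸ hx r hr
        · exact hAR a h r hr) _ hS1 hsum1
      have z1 : ∑ I ∈ S.filter (fun I => x ∈ I),
          pProd n v (XsetI n v I ∩ R) * sub' (sec (spn v I)) (h I) = 0 := by
        apply Finset.sum_eq_zero
        intro I hI
        rw [r1 I hI, map_zero, mul_zero]
      rw [z1, zero_add, map_mul, sub'_pLin] at hsum
      have hne : pLin _ (prj (spn v A) (v x)) ≠ 0 := fun hc =>
        hxs ((prj_eq_zero _ _).1 (pLin_eq_zero hc))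
      have r2 := ih A hAR _ hS2 ((mul_eq_zero.1 hsum).resolve_left hne)
      intro I hI
      by_cases hxI : x ∈ I
      · exact r1 I (Finset.mem_filter.2 ⟨hI, hxI⟩)
      · exact r2 I (Finset.mem_filter.2 ⟨hI, hxI⟩)

/-- remainder space -/
def Trem (W : Submodule ℝ (Fin n → ℝ)) (d : ℕ) : Submodule ℝ (MvPolynomial (Fin n) ℝ) :=
  Submodule.span ℝ {f | ∃ w ∈ W, ∃ (e : ℕ) (r : MvPolynomial (Fin n) ℝ),
    r.IsHomogeneous e ∧ e + 1 = d ∧ f = pLin n w * r}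

lemma Trem_mul (W : Submodule ℝ (Fin n → ℝ)) {d e : ℕ} {f g : MvPolynomial (Fin n) ℝ}
    (hf : f ∈ Trem W d) (hg : g.IsHomogeneous e) : f * g ∈ Trem W (d + e) := by
  induction hf using Submodule.span_induction with
  | mem x hx =>
    obtain ⟨w, hw, e', r, hr, he, rfl⟩ := hx
    apply Submodule.subset_span
    exact ⟨w, hw, e' + e, r * g, hr.mul hg, by omega, by ring⟩
  | zero => simp
  | add x y _ _ hx hy => rw [add_mul]; exact add_mem hx hy
  | smul a x _ hx => rw [smul_mul_assoc]; exact Submodule.smul_mem _ _ hx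

lemma rem_mem_one (W : Submodule ℝ (Fin n → ℝ)) {q : MvPolynomial (Fin n) ℝ}
    (hq : q.IsHomogeneous 1) :
    ∃ w ∈ W, q - sub' (sec W ∘ₗ prj W) q = pLin n w := by
  have hq' : q ∈ homogeneousSubmodule (Fin n) ℝ 1 := hq
  rw [homogeneousSubmodule_one_eq_span_X] at hq'
  induction hq' using Submodule.span_induction with
  | mem x hx =>
    obtain ⟨i, rfl⟩ := hx
    refine ⟨_, sub_sec_prj_mem W (Pi.single i 1), ?_⟩
    rw [sub'_X, ← pLin_single, ← pLinL_apply, ← pLinL_apply, ← pLinL_apply, map_sub]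
    rfl
  | zero => exact ⟨0, W.zero_mem, by simp [pLin_zero]⟩
  | add x y hx hy hx' hy' =>
    rw [← homogeneousSubmodule_one_eq_span_X] at hx hy
    obtain ⟨w, hw, e⟩ := hx' hx
    obtain ⟨w', hw', e'⟩ := hy' hy
    refine ⟨w + w', W.add_mem hw hw', ?_⟩
    rw [pLin_add, ← e, ← e', map_add]; ring
  | smul a x hx hx' =>
    rw [← homogeneousSubmodule_one_eq_span_X] at hx
    obtain ⟨w, hw, e⟩ := hx' hx
    refine ⟨a • w, W.smul_mem _ hw, ?_⟩
    rw [pLin_smul, ← e, map_smul, smul_sub]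

lemma rem_mem (W : Submodule ℝ (Fin n → ℝ)) (d : ℕ) : ∀ {q : MvPolynomial (Fin n) ℝ},
    q.IsHomogeneous d → q - sub' (sec W ∘ₗ prj W) q ∈ Trem W d := by
  induction d with
  | zero =>
    intro q hq
    have := (totalDegree_zero_iff_isHomogeneous (Fin n)).2 hq
    rw [totalDegree_eq_zero_iff_eq_C] at this
    rw [this]
    simp [sub']
  | succ d ih =>
    intro q hq
    have hq' : q ∈ homogeneousSubmodule (Fin n) ℝ (d + 1) := hq
    rw [← homogeneousSubmodule_one_pow, pow_succ, homogeneousSubmodule_one_pow] at hq'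
    clear hq
    induction hq' using Submodule.mul_induction_on' with
    | mem_mul_mem a ha b hb =>
      have e : a * b - sub' (sec W ∘ₗ prj W) (a * b) =
          (a - sub' (sec W ∘ₗ prj W) a) * b +
          (b - sub' (sec W ∘ₗ prj W) b) * sub' (sec W ∘ₗ prj W) a := by
        rw [map_mul]; ring
      rw [e]
      apply add_mem
      · exact Trem_mul W (ih ha) hb
      · obtain ⟨w, hw, e⟩ := rem_mem_one W (q := b) hb
        rw [e]
        apply Submodule.subset_span
        exact ⟨w, hw, d, _, sub'_hom _ ha, rfl, rfl⟩
    | add x hx y hy hx' hy' =>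
      rw [map_add, add_sub_add_comm]
      exact add_mem hx' hy'

lemma LI_of_notMem (I : Finset ι)
    (h : ∀ x ∈ I, v x ∉ Submodule.span ℝ (v '' {b | b ∈ I ∧ b < x})) :
    LinearIndependent ℝ (fun i : I => v i) := by
  change LinearIndepOn ℝ v (I : Set ι)
  induction I using Finset.induction_on_max with
  | empty => simp
  | insert x I hx ih =>
    have hxI : x ∉ I := fun hc => lt_irrefl x (hx x hc)
    rw [Finset.coe_insert, linearIndepOn_insert (by exact_mod_cast hxI)]
    constructor
    · apply ih
      intro y hy hc
      apply h y (Finset.mem_insert_of_mem hy)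
      refine Submodule.span_mono (Set.image_mono ?_) hc
      rintro b ⟨hb, hby⟩
      exact ⟨Finset.mem_insert_of_mem hb, hby⟩
    · intro hc
      apply h x (Finset.mem_insert_self _ _)
      refine Submodule.span_mono (Set.image_mono ?_) hc
      intro b hb
      exact ⟨Finset.mem_insert_of_mem hb, hx b hb⟩

lemma greedy (Z : Finset ι)
    (hst : ∀ y, y ∉ Z → v y ∉ Submodule.span ℝ (v '' {b | b ∈ Z ∧ b < y})) :
    ∃ I : Finset ι, LinearIndependent ℝ (fun i : I => v i) ∧ I ⊆ Z ∧ spn v Z ≤ spn v I ∧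
      XsetI n v I = Finset.univ \ Z := by
  classical
  set I := Z.filter (fun z => v z ∉ Submodule.span ℝ (v '' {b | b ∈ Z ∧ b < z})) with hI
  have key : ∀ z : ι, z ∈ Z → v z ∈ Submodule.span ℝ (v '' {b | b ∈ I ∧ b ≤ z}) := by
    intro z
    induction z using WellFoundedLT.induction with
    | ind z ih =>
      intro hz
      by_cases hzI : z ∈ I
      · exact Submodule.subset_span ⟨z, ⟨hzI, le_rfl⟩, rfl⟩
      · have : v z ∈ Submodule.span ℝ (v '' {b | b ∈ Z ∧ b < z}) := by
          by_contra hc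
          exact hzI (Finset.mem_filter.2 ⟨hz, hc⟩)
        refine Submodule.span_le.2 ?_ this
        rintro _ ⟨b, ⟨hb, hbz⟩, rfl⟩
        refine Submodule.span_mono (Set.image_mono ?_) (ih b hbz hb)
        rintro c ⟨hc, hcb⟩
        exact ⟨hc, hcb.trans hbz.le⟩
  have key2 : ∀ y : ι, Submodule.span ℝ (v '' {b | b ∈ I ∧ b < y}) =
      Submodule.span ℝ (v '' {b | b ∈ Z ∧ b < y}) := by
    intro y
    apply le_antisymm
    · apply Submodule.span_mono (Set.image_mono ?_)
      rintro b ⟨hb, hby⟩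
      exact ⟨(Finset.mem_filter.1 hb).1, hby⟩
    · apply Submodule.span_le.2
      rintro _ ⟨b, ⟨hb, hby⟩, rfl⟩
      refine Submodule.span_mono (Set.image_mono ?_) (key b hb)
      rintro c ⟨hc, hcb⟩
      exact ⟨hc, hcb.trans_lt hby⟩
  refine ⟨I, ?_, Finset.filter_subset _ _, ?_, ?_⟩
  · apply LI_of_notMem
    intro x hx
    rw [key2]
    exact (Finset.mem_filter.1 hx).2
  · apply Submodule.span_le.2
    rintro _ ⟨b, hb, rfl⟩
    refine Submodule.span_mono (Set.image_mono ?_) (key b hb)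
    rintro c ⟨hc, _⟩
    exact hc
  · ext y
    rw [mem_XsetI, key2]
    simp only [Finset.mem_sdiff, Finset.mem_univ, true_and]
    constructor
    · rintro ⟨h1, h2⟩ hc
      exact h1 (Finset.mem_filter.2 ⟨hc, h2⟩)
    · intro h
      exact ⟨fun hc => h (Finset.mem_filter.1 hc).1, hst y h⟩

lemma straighten (k : Finset ι → ℕ) (hsolid : Solid n v k) (hinc : Incremental k) (j : ℕ)
    (S : Submodule ℝ (MvPolynomial (Fin n) ℝ))
    (hS : ∀ I : Finset ι, LinearIndependent ℝ (fun i : I => v i) → ∀ (d : ℕ)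
      (h : MvPolynomial (Fin (cod (spn v I))) ℝ), h.IsHomogeneous d → d ≤ k I →
      d + (XsetI n v I).card = j → pProd n v (XsetI n v I) * sub' (sec (spn v I)) h ∈ S) :
    ∀ (d μ : ℕ) (Z : Finset ι) (q : MvPolynomial (Fin n) ℝ), q.IsHomogeneous d → d ≤ k Z →
      d + (Finset.univ \ Z).card = j →
      ∑ y ∈ Finset.univ \ Z, (Finset.univ.filter (· < y)).card = μ →
      pProd n v (Finset.univ \ Z) * q ∈ S := by
  intro d
  induction d using Nat.strong_induction_on with
  | _ d ihd =>
  intro μ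
  induction μ using Nat.strong_induction_on with
  | _ μ ihμ =>
  intro Z q hq hdk hdj hμ
  by_cases hst : ∀ y, y ∉ Z → v y ∉ Submodule.span ℝ (v '' {b | b ∈ Z ∧ b < y})
  · obtain ⟨I, hI, hIZ, hsp, hX⟩ := greedy v Z hst
    have e : q = sub' (sec (spn v I)) (sub' (prj (spn v I)) q) +
        (q - sub' (sec (spn v I) ∘ₗ prj (spn v I)) q) := by
      rw [sub'_comp]; ring
    rw [e, mul_add]
    apply add_mem
    · rw [← hX] at hdj ⊢
      exact hS I hI d _ (sub'_hom _ hq) (hdk.trans (hsolid _ _ hsp)) hdj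
    · have hr := rem_mem (spn v I) d hq
      generalize q - sub' (sec (spn v I) ∘ₗ prj (spn v I)) q = f at hr
      induction hr using Submodule.span_induction with
      | zero => simp
      | add x y _ _ hx hy => rw [mul_add]; exact add_mem hx hy
      | smul a x _ hx => rw [mul_smul_comm]; exact Submodule.smul_mem _ _ hx
      | mem x hx =>
        obtain ⟨w, hw, e', r, hr, he, rfl⟩ := hx
        change w ∈ Submodule.span ℝ _ at hw
        induction hw using Submodule.span_induction with
        | zero => simp [pLin_zero]
        | add x y _ _ hx hy => rw [pLin_add, add_mul, mul_add]; exact add_mem hx hy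
        | smul a x _ hx =>
          rw [pLin_smul, smul_mul_assoc, mul_smul_comm]; exact Submodule.smul_mem _ _ hx
        | mem x hx =>
          obtain ⟨b, hb, rfl⟩ := hx
          have hbZ : b ∈ Z := hIZ hb
          have hset : Finset.univ \ Z.erase b = insert b (Finset.univ \ Z) := by
            ext c
            simp only [Finset.mem_sdiff, Finset.mem_univ, true_and, Finset.mem_erase,
              Finset.mem_insert]
            tauto
          have hnot : b ∉ Finset.univ \ Z := by simp [hbZ]
          have hprod : pProd n v (Finset.univ \ Z) * (pLin n (v b) * r) =
              pProd n v (Finset.univ \ Z.erase b) * r := by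
            rw [hset, pProd, pProd, Finset.prod_insert hnot]; ring
          rw [hprod]
          have hk := hinc (Z.erase b) b
          rw [Finset.insert_erase hbZ] at hk
          refine ihd e' (by omega) _ (Z.erase b) r hr (by omega) ?_ rfl
          rw [hset, Finset.card_insert_of_notMem hnot]
          omega
  · push Not at hst
    obtain ⟨y, hyZ, hy⟩ := hst
    have hyZ' : y ∈ Finset.univ \ Z := by simp [hyZ]
    have hcoe : {b | b ∈ Z ∧ b < y} = ((Z.filter (· < y) : Finset ι) : Set ι) := by
      ext b; simp
    rw [hcoe, Submodule.mem_span_image_finset_iff_exists_fun'] at hy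
    obtain ⟨c, hc⟩ := hy
    have hprod : pProd n v (Finset.univ \ Z) * q =
        ∑ z ∈ Z.filter (· < y), c z • (pLin n (v z) * pProd n v ((Finset.univ \ Z).erase y) * q) := by
      rw [pProd, ← Finset.mul_prod_erase _ _ hyZ', ← hc, ← pLinL_apply, map_sum, Finset.sum_mul,
        Finset.sum_mul]
      apply Finset.sum_congr rfl
      intro z _
      rw [map_smul, smul_mul_assoc, smul_mul_assoc]
      rfl
    rw [hprod]
    apply Submodule.sum_mem
    intro z hz
    obtain ⟨hzZ, hzy⟩ := Finset.mem_filter.1 hz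
    by_cases hcz : c z = 0
    · simp [hcz]
    apply Submodule.smul_mem
    set Z' := insert y (Z.erase z) with hZ'
    have hzny : z ≠ y := ne_of_lt hzy
    have hset : Finset.univ \ Z' = insert z ((Finset.univ \ Z).erase y) := by
      ext b
      simp only [hZ', Finset.mem_sdiff, Finset.mem_univ, true_and, Finset.mem_erase,
        Finset.mem_insert]
      by_cases h1 : b = z
      · subst h1; simp [hzny]
      · simp [h1]
    have hnot : z ∉ (Finset.univ \ Z).erase y := by simp [hzZ]
    have hp : pLin n (v z) * pProd n v ((Finset.univ \ Z).erase y) =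
        pProd n v (Finset.univ \ Z') := by
      rw [hset, pProd, pProd, Finset.prod_insert hnot]
    rw [hp]
    have hyspan : v y ∈ spn v Z' := Submodule.subset_span ⟨y, by simp [hZ'], rfl⟩
    have hother : ∀ b ∈ Z, b ≠ z → v b ∈ spn v Z' := fun b hb hbz =>
      Submodule.subset_span ⟨b, by simp [hZ', hb, hbz], rfl⟩
    have hzspan : v z ∈ spn v Z' := by
      rw [← Finset.add_sum_erase _ _ hz] at hc
      have h1 : c z • v z ∈ spn v Z' := by
        rw [eq_sub_of_add_eq hc]
        apply sub_mem hyspan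
        apply Submodule.sum_mem
        intro b hb
        obtain ⟨hb1, hb2⟩ := Finset.mem_erase.1 hb
        exact Submodule.smul_mem _ _ (hother b (Finset.mem_filter.1 hb2).1 hb1)
      exact ((spn v Z').smul_mem_iff hcz).1 h1
    have hk : k Z ≤ k Z' := by
      apply hsolid
      apply Submodule.span_le.2
      rintro _ ⟨b, hb, rfl⟩
      by_cases hbz : b = z
      · rw [hbz]; exact hzspan
      · exact hother b hb hbz
    refine ihμ _ ?_ Z' q hq (hdk.trans hk) ?_ rfl
    · rw [hset, Finset.sum_insert hnot, ← hμ, ← Finset.add_sum_erase _ _ hyZ']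
      apply Nat.add_lt_add_right
      apply Finset.card_lt_card
      rw [Finset.ssubset_iff_of_subset]
      · exact ⟨z, by simp [hzy], by simp⟩
      · intro b hb
        simp only [Finset.mem_filter, Finset.mem_univ, true_and] at hb ⊢
        exact hb.trans hzy
    · rw [hset, Finset.card_insert_of_notMem hnot, Finset.card_erase_of_mem hyZ']
      have : 0 < (Finset.univ \ Z).card := Finset.card_pos.2 ⟨y, hyZ'⟩
      omega

lemma Pspace_hom_le (k : Finset ι → ℕ) (j : ℕ) (S : Submodule ℝ (MvPolynomial (Fin n) ℝ))
    (hS : ∀ (d : ℕ) (Z : Finset ι) (q : MvPolynomial (Fin n) ℝ), q.IsHomogeneous d → d ≤ k Z →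
      d + (Finset.univ \ Z).card = j → pProd n v (Finset.univ \ Z) * q ∈ S) :
    Pspace n v k ⊓ MvPolynomial.homogeneousSubmodule (Fin n) ℝ j ≤ S := by
  have h1 : Pspace n v k ≤ S.comap (homogeneousComponent j) := by
    apply iSup_le
    intro Z
    rintro _ ⟨q, hq, rfl⟩
    have hq' : q.totalDegree ≤ k Z := (mem_restrictTotalDegree _ _ _).1 hq
    rw [Submodule.mem_comap, LinearMap.mulLeft_apply, ← sum_homogeneousComponent q,
      Finset.mul_sum, map_sum]
    apply Submodule.sum_mem
    intro d hd
    have hh := (pProd_hom n v (Finset.univ \ Z)).mul (homogeneousComponent_isHomogeneous d q)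
    rw [homogeneousComponent_of_mem hh]
    split_ifs with he
    · refine hS d Z _ (homogeneousComponent_isHomogeneous d q) ?_ (by omega)
      have := Finset.mem_range.1 hd
      omega
    · exact S.zero_mem
  rintro f ⟨hf1, hf2⟩
  have := h1 hf1
  rw [Submodule.mem_comap, homogeneousComponent_of_mem hf2] at this
  simpa using this

lemma k_XsetI (k : Finset ι → ℕ) (hsolid : Solid n v k) (I : Finset ι) :
    k I ≤ k (Finset.univ \ XsetI n v I) := by
  apply hsolid
  apply Submodule.span_mono (Set.image_mono ?_)
  intro b hb
  have : b ∈ I := hb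
  simp [mem_XsetI, this]

lemma term_mem (k : Finset ι → ℕ) (hsolid : Solid n v k) (I : Finset ι) (d : ℕ)
    {q : MvPolynomial (Fin n) ℝ} (hq : q.IsHomogeneous d) (hd : d ≤ k I) :
    pProd n v (XsetI n v I) * q ∈ Pspace n v k := by
  apply Submodule.mem_iSup_of_mem (Finset.univ \ XsetI n v I)
  refine ⟨q, ?_, ?_⟩
  · change q ∈ restrictTotalDegree _ _ _
    rw [mem_restrictTotalDegree]
    exact hq.totalDegree_le.trans (hd.trans (k_XsetI v k hsolid I))
  · simp

/-- the index set -/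
def Idx (k : Finset ι → ℕ) (j : ℕ) : Type := {I : Finset ι //
  LinearIndependent ℝ (fun i : I => v i) ∧ j ≤ k I + (XsetI n v I).card ∧ (XsetI n v I).card ≤ j}

instance (k : Finset ι → ℕ) (j : ℕ) : Fintype (Idx v k j) := by
  classical
  unfold Idx
  infer_instance

/-- the parametrization -/
def Phi (k : Finset ι → ℕ) (j : ℕ) :
    ((I : Idx v k j) → homogeneousSubmodule (Fin (cod (spn v I.1))) ℝ (j - (XsetI n v I.1).card))
      →ₗ[ℝ] MvPolynomial (Fin n) ℝ :=
  ∑ I : Idx v k j, LinearMap.mulLeft ℝ (pProd n v (XsetI n v I.1)) ∘ₗ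
    (sub' (sec (spn v I.1))).toLinearMap ∘ₗ Submodule.subtype _ ∘ₗ LinearMap.proj I

lemma Phi_apply (k : Finset ι → ℕ) (j : ℕ) (h) : Phi v k j h =
    ∑ I : Idx v k j, pProd n v (XsetI n v I.1) * sub' (sec (spn v I.1)) (h I).1 := by
  simp [Phi, LinearMap.sum_apply]

lemma Phi_inj (k : Finset ι → ℕ) (j : ℕ) : Function.Injective (Phi v k j) := by
  classical
  rw [← LinearMap.ker_eq_bot, LinearMap.ker_eq_bot']
  intro h hh
  rw [Phi_apply] at hh
  let P : Finset ι → Prop := fun I => LinearIndependent ℝ (fun i : I => v i) ∧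
    j ≤ k I + (XsetI n v I).card ∧ (XsetI n v I).card ≤ j
  let H : ∀ I : Finset ι, MvPolynomial (Fin (cod (spn v I))) ℝ := fun I =>
    if hI : P I then (h ⟨I, hI⟩).1 else 0
  have hH : ∀ I : Idx v k j, H I.1 = (h I).1 := by
    intro I
    have : P I.1 := I.2
    simp only [H, dif_pos this]
    rfl
  have key := indep_aux v H Finset.univ ∅ (by simp)
    (Finset.univ.filter (fun I : Finset ι => LinearIndependent ℝ (fun i : I => v i))) (by simp) (by
      have e : ∑ I ∈ Finset.univ.filter (fun I : Finset ι => LinearIndependent ℝ (fun i : I => v i)),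
          pProd n v (XsetI n v I ∩ Finset.univ) * sub' (sec (spn v I)) (H I) = 0 := by
        rw [← hh]
        have e1 : ∑ I : Idx v k j, pProd n v (XsetI n v I.1) * sub' (sec (spn v I.1)) (h I).1 =
            ∑ I : Idx v k j, pProd n v (XsetI n v I.1) * sub' (sec (spn v I.1)) (H I.1) := by
          simp only [hH]
        rw [e1]
        have e2 := Finset.sum_subtype (F := (inferInstance : Fintype (Idx v k j))) (Finset.univ.filter P) (p := P)
            (by simp)
          (fun I => pProd n v (XsetI n v I) * sub' (sec (spn v I)) (H I))
        refine Eq.trans ?_ (e2.trans ?_)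
        · simp only [Finset.inter_univ]
          symm
          apply Finset.sum_subset
          · intro I hI
            simp only [Finset.mem_filter, Finset.mem_univ, true_and] at hI ⊢
            exact hI.1
          · intro I _ hI
            have : ¬ P I := by simpa using hI
            simp [H, this]
        · exact Fintype.sum_equiv (Equiv.refl _) _ _ (fun _ => rfl)
      rw [e, map_zero])
  funext I
  apply Subtype.ext
  rw [← hH I]
  exact key I.1 (by simpa using I.2.1)

lemma Phi_range (k : Finset ι → ℕ) (hsolid : Solid n v k) (hinc : Incremental k) (j : ℕ) :
    LinearMap.range (Phi v k j) =
      Pspace n v k ⊓ MvPolynomial.homogeneousSubmodule (Fin n) ℝ j := by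
  classical
  apply le_antisymm
  · rintro _ ⟨h, rfl⟩
    rw [Phi_apply]
    apply Submodule.sum_mem
    intro I _
    have hh : (h I).1.IsHomogeneous _ := (h I).2
    have h3 := I.2.2.1
    have h4 := I.2.2.2
    refine ⟨term_mem v k hsolid I.1 _ (sub'_hom _ hh) (by omega), ?_⟩
    have := (pProd_hom n v (XsetI n v I.1)).mul (sub'_hom (sec (spn v I.1)) hh)
    rw [Nat.add_sub_cancel' h4] at this
    exact this
  · apply Pspace_hom_le
    intro d Z q hq hd hj
    refine straighten v k hsolid hinc j _ ?_ d _ Z q hq hd hj rfl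
    intro I hI d h hh hdk hdj
    let I' : Idx v k j := ⟨I, hI, by omega, by omega⟩
    have hh' : h ∈ homogeneousSubmodule (Fin (cod (spn v I'.1))) ℝ (j - (XsetI n v I'.1).card) := by
      have : j - (XsetI n v I).card = d := by omega
      change h ∈ homogeneousSubmodule (Fin (cod (spn v I))) ℝ (j - (XsetI n v I).card)
      rw [this]; exact hh
    refine ⟨Pi.single I' ⟨h, hh'⟩, ?_⟩
    rw [Phi_apply, Finset.sum_eq_single I']
    · simp
      rfl
    · intro b _ hb
      simp [Pi.single_eq_of_ne hb]
    · simp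

lemma cod_spn {I : Finset ι} (hI : LinearIndependent ℝ (fun i : I => v i)) :
    I.card + cod (spn v I) = n := by
  have h1 := (spn v I).finrank_quotient_add_finrank
  have h2 := finrank_span_eq_card hI
  have e : Set.range (fun i : I => v i) = v '' (I : Set ι) := by
    ext w; simp
  rw [e] at h2
  simp only [Module.finrank_fintype_fun_eq_card, Fintype.card_fin, Fintype.card_coe] at h1 h2
  change Module.finrank ℝ (spn v I) = _ at h2
  change cod (spn v I) + _ = _ at h1
  omega

lemma basis_iff {I : Finset ι} (hI : LinearIndependent ℝ (fun i : I => v i)) :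
    IsBasisSet n v I ↔ cod (spn v I) = 0 := by
  rw [IsBasisSet, and_iff_right hI]
  change spn v I = ⊤ ↔ _
  rw [cod, Module.finrank_zero_iff, Submodule.Quotient.subsingleton_iff]

lemma main_aux (k : Finset ι → ℕ) (hsolid : Solid n v k) (hinc : Incremental k) (j : ℕ) :
    Module.finrank ℝ
        ↥(Pspace n v k ⊓ MvPolynomial.homogeneousSubmodule (Fin n) ℝ j) =
      hilbRHS n ι v k j := by
  classical
  rw [← Phi_range v k hsolid hinc j, LinearMap.finrank_range_of_inj (Phi_inj v k j)]
  have hfin : ∀ m d, Module.Finite ℝ (homogeneousSubmodule (Fin m) ℝ d) := fun m d =>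
    Module.Finite.iff_fg.2 (homogeneousSubmodule_fg _ _ d)
  rw [Module.finrank_pi_fintype]
  simp only [finrank_hom]
  let P : Finset ι → Prop := fun I => LinearIndependent ℝ (fun i : I => v i) ∧
    j ≤ k I + (XsetI n v I).card ∧ (XsetI n v I).card ≤ j
  have e2 := Finset.sum_subtype (F := (inferInstance : Fintype (Idx v k j))) (Finset.univ.filter P) (p := P)
            (by simp)
          (fun I => Nat.multichoose (cod (spn v I)) (j - (XsetI n v I).card))
  refine Eq.trans (Fintype.sum_equiv (Equiv.refl _) _ _ (fun _ => rfl)) (e2.symm.trans ?_)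
  rw [← Finset.sum_filter_add_sum_filter_not _ (fun I => IsBasisSet n v I)]
  unfold hilbRHS
  congr 1
  · rw [Finset.filter_filter]
    have e3 : {B : Finset ι | IsBasisSet n v B ∧ (XsetI n v B).card = j} =
      ((Finset.univ.filter (fun B => IsBasisSet n v B ∧ (XsetI n v B).card = j) :
        Finset (Finset ι)) : Set (Finset ι)) := by
      ext; simp
    rw [e3, Set.ncard_coe_finset, Finset.card_eq_sum_ones]
    symm
    apply Finset.sum_subset_zero_on_sdiff
    · intro B hB
      simp only [Finset.mem_filter, Finset.mem_univ, true_and] at hB ⊢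
      exact ⟨⟨hB.1.1, by omega, by omega⟩, hB.1⟩
    · intro B hB
      simp only [Finset.mem_filter, Finset.mem_univ, true_and, Finset.mem_sdiff] at hB
      obtain ⟨⟨⟨h1, h2, h3⟩, h4⟩, h5⟩ := hB
      rw [(basis_iff v h1).1 h4]
      obtain ⟨d, hd⟩ : ∃ d, j - (XsetI n v B).card = d + 1 :=
        ⟨j - (XsetI n v B).card - 1, by have : (XsetI n v B).card ≠ j := fun h => h5 ⟨h4, h⟩; omega⟩
      rw [hd, Nat.multichoose_zero_succ]
    · intro B hB
      simp only [Finset.mem_filter, Finset.mem_univ, true_and] at hB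
      rw [hB.2, Nat.sub_self, Nat.multichoose_zero_right]
  · rw [Finset.filter_filter]
    apply Finset.sum_congr
    · ext I
      simp only [Finset.mem_filter, Finset.mem_univ, true_and, P]
      constructor
      · rintro ⟨⟨h1, h2, h3⟩, h4⟩
        exact ⟨h1, h4, by omega, h3⟩
      · rintro ⟨h1, h4, h2, h3⟩
        exact ⟨⟨h1, by omega, h3⟩, h4⟩
    · intro I hI
      simp only [Finset.mem_filter, Finset.mem_univ, true_and] at hI
      obtain ⟨h1, h4, h2, h3⟩ := hI
      have hc := cod_spn v h1
      have hb : cod (spn v I) ≠ 0 := fun h => h4 ((basis_iff v h1).2 h)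
      rw [Nat.multichoose_eq]
      rw [← Nat.choose_symm (by omega)]
      congr 1 <;> omega

end comb

end

/-- the Hilbert function of `𝒫_k` for a solid and incremental assignment. -/
theorem statement15
    (n : ℕ) (hn : 1 ≤ n) (ι : Type) [Fintype ι] [DecidableEq ι]
    (v : ι → Fin n → ℝ) (M : ℕ) (y : Fin M → Fin n → ℝ)
    (hspan : Submodule.span ℝ (Set.range (Sum.elim v y)) = ⊤)
    (hgen : GeneralPosition n v y)
    (k : Finset ι → ℕ) (hsolid : Solid n v k)
    (hM : ∀ I : Finset ι, (LinearIndependent ℝ fun i : I => v i) → mVal n k I ≤ M)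
    (hinc : Incremental k) [LinearOrder ι] (j : ℕ) :
    Module.finrank ℝ
        ↥(Pspace n v k ⊓ MvPolynomial.homogeneousSubmodule (Fin n) ℝ j) =
      hilbRHS n ι v k j := by
  obtain rfl : ‹DecidableEq ι› = LinearOrder.toDecidableEq := Subsingleton.elim _ _
  exact main_aux v k hsolid hinc j
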